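/- arXiv:1808.06724 — 3 statements merged into one kernel-verified Lean document; each statement's English description precedes it below -/
import Mathlib

section
/- Let ℍ denote the real quaternions with imaginary unit i, and consider 2×2 matrices over ℍ with the commutator bracket ⁅A,B⁆ = AB − BA. Let a ∈ ℍ be a nonzero quaternion, and set H = [[i,0],[0,0]], X = [[0,a],[−ā,0]] (ā the quaternion conjugate of a), and Y = ⁅H,X⁆. Then: (1) Y = [[0, i·a],[ā·i, 0]]; (2) ⁅X,Y⁆ = [[2|a|²·i, 0],[0, −2·ā·i·a]], where |a|² = a·ā is the (real) squared norm of a; and (3) ⁅X,Y⁆ does not belong to the real linear span of {H, X, Y}. In particular, for a ≠ 0 the real span of {H, X, Y} is not closed under the commutator bracket. -/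
/-- **Case III-C computation.** In `M₂(ℍ)`, with `i` the quaternion imaginary unit,
`H = [[i,0],[0,0]]`, `X = [[0,a],[-ā,0]]` for a nonzero quaternion `a`, and
`Y = HX - XH`, one has `Y = [[0, i·a],[ā·i, 0]]`,
`XY - YX = [[2|a|²·i, 0],[0, -2·ā·i·a]]`, and `XY - YX` is not in the real linear span
of `{H, X, Y}`; in particular this span is not closed under the commutator bracket. -/
theorem sp2_A1_span_not_closed_under_bracket
    (a : Quaternion ℝ) (ha : a ≠ 0)
    (qI : Quaternion ℝ) (hqI : qI = ⟨0, 1, 0, 0⟩)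
    (H X Y : Matrix (Fin 2) (Fin 2) (Quaternion ℝ))
    (hH : H = !![qI, 0; 0, 0])
    (hX : X = !![0, a; -star a, 0])
    (hY : Y = H * X - X * H) :
    Y = !![0, qI * a; star a * qI, 0] ∧
    X * Y - Y * X =
      !![((2 * Quaternion.normSq a : ℝ) : Quaternion ℝ) * qI, 0;
         0, -(2 : Quaternion ℝ) * (star a * qI * a)] ∧
    X * Y - Y * X ∉ Submodule.span ℝ ({H, X, Y} : Set (Matrix (Fin 2) (Fin 2) (Quaternion ℝ))) ∧
    ¬ (∀ A ∈ Submodule.span ℝ ({H, X, Y} : Set (Matrix (Fin 2) (Fin 2) (Quaternion ℝ))),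
        ∀ B ∈ Submodule.span ℝ ({H, X, Y} : Set (Matrix (Fin 2) (Fin 2) (Quaternion ℝ))),
          A * B - B * A ∈ Submodule.span ℝ
            ({H, X, Y} : Set (Matrix (Fin 2) (Fin 2) (Quaternion ℝ)))) := by
  have h1 : Y = !![0, qI * a; star a * qI, 0] := by
    rw [hY, hH, hX]
    ext i j : 1
    fin_cases i <;> fin_cases j <;> simp [Matrix.mul_apply, Fin.sum_univ_two]
  have h2 : X * Y - Y * X =
      !![((2 * Quaternion.normSq a : ℝ) : Quaternion ℝ) * qI, 0;
         0, -(2 : Quaternion ℝ) * (star a * qI * a)] := by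
    have e1 : a * (star a * qI) + qI * a * star a
        = ((2 * Quaternion.normSq a : ℝ) : Quaternion ℝ) * qI := by
      rw [← mul_assoc, mul_assoc qI, Quaternion.self_mul_star,
        ← Quaternion.coe_commutes, ← add_mul, ← Quaternion.coe_add, ← two_mul]
    have e2 : -(star a * (qI * a)) - star a * qI * a
        = -(2 : Quaternion ℝ) * (star a * qI * a) := by
      rw [← mul_assoc, neg_mul, two_mul]; abel
    rw [h1, hX]
    ext i j : 1
    fin_cases i <;> fin_cases j
    · simpa [Matrix.mul_apply, Fin.sum_univ_two] using e1
    · simp [Matrix.mul_apply, Fin.sum_univ_two]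
    · simp [Matrix.mul_apply, Fin.sum_univ_two]
    · simpa [Matrix.mul_apply, Fin.sum_univ_two] using e2
  have hq : qI ≠ 0 := by
    intro h
    have h0 : (1 : ℝ) = 0 := congrArg (fun q : Quaternion ℝ => q.imI) (hqI.symm.trans h)
    exact one_ne_zero h0
  have h3 : X * Y - Y * X ∉ Submodule.span ℝ
      ({H, X, Y} : Set (Matrix (Fin 2) (Fin 2) (Quaternion ℝ))) := by
    intro hm
    obtain ⟨r, s, t, h⟩ := Submodule.mem_span_triple.1 hm
    rw [h2, h1, hX, hH] at h
    have h' := congrFun (congrFun h 1) 1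
    have hs : star a ≠ 0 := star_ne_zero.2 ha
    have htwo : (2 : Quaternion ℝ) ≠ 0 := by
      intro h
      have h0 : (2 : ℝ) = 0 := congrArg (fun q : Quaternion ℝ => q.re) h
      exact two_ne_zero h0
    have hne : -(2 : Quaternion ℝ) * (star a * qI * a) ≠ 0 :=
      mul_ne_zero (neg_ne_zero.2 htwo) (mul_ne_zero (mul_ne_zero hs hq) ha)
    apply hne
    simpa using h'.symm
  refine ⟨h1, h2, h3, fun hc => h3 (hc X (Submodule.subset_span ?_) Y (Submodule.subset_span ?_))⟩
  · simp
  · simp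
end

section
/- Let g ∈ M₃(ℂ) be the cyclic permutation matrix with rows (0,1,0), (0,0,1), (1,0,0), and define u, v ∈ M₃(ℂ) by u = [[0,1,−1],[−1,0,1],[1,−1,0]] and v = i·[[0,1,1],[1,0,1],[1,1,0]] (i the imaginary unit). Then the set of matrices X ∈ M₃(ℂ) satisfying Xᴴ = −X (skew-Hermitian), trace X = 0, and gX = Xg equals the real linear span of {u, v}. Moreover u and v commute (uv = vu), and the only diagonal matrix contained in this span is the zero matrix. -/
open scoped Matrix

/-- **Centralizer computation in su(3).** For the cyclic permutation matrix `g ∈ SU(3)`,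
the set of traceless skew-Hermitian `3×3` complex matrices commuting with `g` is the real
span of the displayed matrices `u` and `v`; moreover `u` and `v` commute, and the only
diagonal matrix in this span is `0`. -/
theorem centralizer_in_su3_eq_span
    (g u v : Matrix (Fin 3) (Fin 3) ℂ)
    (hg : g = !![0, 1, 0; 0, 0, 1; 1, 0, 0])
    (hu : u = !![0, 1, -1; -1, 0, 1; 1, -1, 0])
    (hv : v = Complex.I • !![0, 1, 1; 1, 0, 1; 1, 1, 0]) :
    {X : Matrix (Fin 3) (Fin 3) ℂ | Xᴴ = -X ∧ X.trace = 0 ∧ g * X = X * g} =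
      ↑(Submodule.span ℝ ({u, v} : Set (Matrix (Fin 3) (Fin 3) ℂ))) ∧
    u * v = v * u ∧
    ∀ X ∈ Submodule.span ℝ ({u, v} : Set (Matrix (Fin 3) (Fin 3) ℂ)), X.IsDiag → X = 0 := by
  subst hg hu hv
  refine ⟨?_, ?_, ?_⟩
  · ext X
    simp only [Set.mem_setOf_eq, SetLike.mem_coe, Submodule.mem_span_pair]
    constructor
    · rintro ⟨hs, ht, hc⟩
      have s (i j : Fin 3) := congrFun (congrFun hs i) j
      have c (i j : Fin 3) := congrFun (congrFun hc i) j
      have c00 := c 0 0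
      have c01 := c 0 1
      have c02 := c 0 2
      have c10 := c 1 0
      have c11 := c 1 1
      have c12 := c 1 2
      have s10 := s 1 0
      simp [Matrix.mul_apply, Fin.sum_univ_three] at c00 c01 c02 c10 c11 c12
      simp [Matrix.conjTranspose_apply] at s10
      simp [Matrix.trace, Fin.sum_univ_three] at ht
      have h00 : X 0 0 = 0 := by grind
      have h11 : X 1 1 = 0 := by grind
      have h22 : X 2 2 = 0 := by grind
      have h12 : X 1 2 = X 0 1 := by grind
      have h20 : X 2 0 = X 0 1 := by grind
      have h10 : X 1 0 = -(starRingEnd ℂ) (X 0 1) := by grind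
      have h21 : X 2 1 = -(starRingEnd ℂ) (X 0 1) := by grind
      have h02 : X 0 2 = -(starRingEnd ℂ) (X 0 1) := by grind
      refine ⟨(X 0 1).re, (X 0 1).im, ?_⟩
      ext i j
      fin_cases i <;> fin_cases j <;>
        simp [h00, h11, h22, h12, h20, h10, h21, h02, Complex.ext_iff]
    · rintro ⟨a, b, rfl⟩
      refine ⟨?_, ?_, ?_⟩
      · ext i j
        fin_cases i <;> fin_cases j <;>
          simp [Complex.ext_iff]
      · simp [Matrix.trace, Fin.sum_univ_three]
      · ext i j
        fin_cases i <;> fin_cases j <;>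
          simp [Matrix.mul_apply, Fin.sum_univ_three]
  · ext i j
    fin_cases i <;> fin_cases j <;>
      simp [Matrix.mul_apply, Fin.sum_univ_three]
  · intro X hX hd
    obtain ⟨a, b, rfl⟩ := Submodule.mem_span_pair.1 hX
    have h := hd (show (0 : Fin 3) ≠ 1 by decide)
    simp [Complex.ext_iff] at h
    simp [h.1, h.2]
end

section
/- Let ℍ denote the real quaternions, and let g ∈ M₃(ℍ) be the cyclic permutation matrix with rows (0,1,0), (0,0,1), (1,0,0). Define u = [[0,1,−1],[−1,0,1],[1,−1,0]], v₁ the all-ones 3×3 matrix, and v₂ = [[−2,1,1],[1,−2,1],[1,1,−2]], all viewed as matrices over ℍ. Then the set of matrices X ∈ M₃(ℍ) satisfying Xᴴ = −X (where Xᴴ is the transpose of the entrywise quaternion conjugate) and gX = Xg equals the set { q₁·v₁ + q₂·v₂ + t·u : q₁, q₂ ∈ ℍ purely imaginary, t ∈ ℝ }. Moreover, for all purely imaginary quaternions q₁, q₂, the matrices q₁·v₁, q₂·v₂, and u pairwise commute: ⁅q₁·v₁, q₂·v₂⁆ = 0, ⁅q₁·v₁, u⁆ = 0, and ⁅q₂·v₂,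 u⁆ = 0, where ⁅A,B⁆ = AB − BA. -/
open scoped Matrix

set_option maxHeartbeats 4000000 in
/-- **Centralizer computation in sp(3).** For the cyclic permutation matrix
`g ∈ Sp(3) ⊂ M₃(ℍ)`, the set of anti-Hermitian quaternionic `3×3` matrices commuting
with `g` consists exactly of the matrices `q₁ • v₁ + q₂ • v₂ + t • u` with `q₁, q₂`
purely imaginary quaternions and `t` real; moreover these pieces pairwise commute. -/
theorem centralizer_in_sp3_eq_sum
    (g u v₁ v₂ : Matrix (Fin 3) (Fin 3) (Quaternion ℝ))
    (hg : g = !![0, 1, 0; 0, 0, 1; 1, 0, 0])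
    (hu : u = !![0, 1, -1; -1, 0, 1; 1, -1, 0])
    (hv₁ : v₁ = !![1, 1, 1; 1, 1, 1; 1, 1, 1])
    (hv₂ : v₂ = !![-2, 1, 1; 1, -2, 1; 1, 1, -2]) :
    {X : Matrix (Fin 3) (Fin 3) (Quaternion ℝ) | Xᴴ = -X ∧ g * X = X * g} =
      {X | ∃ (q₁ q₂ : Quaternion ℝ) (t : ℝ), q₁.re = 0 ∧ q₂.re = 0 ∧
        X = q₁ • v₁ + q₂ • v₂ + t • u} ∧
    ∀ (q₁ q₂ : Quaternion ℝ), q₁.re = 0 → q₂.re = 0 →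
      ((q₁ • v₁) * (q₂ • v₂) - (q₂ • v₂) * (q₁ • v₁) = 0 ∧
       (q₁ • v₁) * u - u * (q₁ • v₁) = 0 ∧
       (q₂ • v₂) * u - u * (q₂ • v₂) = 0) := by
  have t0 : (2 : Quaternion ℝ).re = 2 := rfl
  have t1 : (2 : Quaternion ℝ).imI = 0 := rfl
  have t2 : (2 : Quaternion ℝ).imJ = 0 := rfl
  have t3 : (2 : Quaternion ℝ).imK = 0 := rfl
  have e0 : (1 : Quaternion ℝ).re = 1 := rfl
  have e1 : (1 : Quaternion ℝ).imI = 0 := rfl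
  have e2 : (1 : Quaternion ℝ).imJ = 0 := rfl
  have e3 : (1 : Quaternion ℝ).imK = 0 := rfl
  subst hg hu hv₁ hv₂
  refine ⟨?_, ?_⟩
  · ext X
    simp only [Set.mem_ofPred_eq]
    constructor
    · rintro ⟨hX, hc⟩
      have h := fun i j => congrFun (congrFun hX i) j
      have k := fun i j => congrFun (congrFun hc i) j
      have h00 := h 0 0
      have h01 := h 0 1
      have k01 := k 0 0
      have k02 := k 0 1
      have k03 := k 0 2
      have k11 := k 1 0
      have k12 := k 1 1
      have k13 := k 1 2
      clear h k hX hc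
      simp [Matrix.mul_apply, Fin.sum_univ_three] at h00 h01 k01 k02 k03 k11 k12 k13
      rw [k01] at k12
      rw [k02] at k13
      rw [k03] at k11
      rw [k01] at h01
      have a0 : (X 0 0).re = 0 := h00
      have b0 := congrArg QuaternionAlgebra.re h01
      have b1 := congrArg QuaternionAlgebra.imI h01
      have b2 := congrArg QuaternionAlgebra.imJ h01
      have b3 := congrArg QuaternionAlgebra.imK h01
      simp at b0 b1 b2 b3
      have hq : ∀ a b c : ℝ, ∃ q : Quaternion ℝ, q.re = 0 ∧ q.imI = a ∧ q.imJ = b ∧ q.imK = c :=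
        fun a b c => ⟨⟨0, a, b, c⟩, rfl, rfl, rfl, rfl⟩
      obtain ⟨q₁, p0, p1, p2, p3⟩ := hq ((2 * (X 0 1).imI + (X 0 0).imI) / 3)
        ((2 * (X 0 1).imJ + (X 0 0).imJ) / 3) ((2 * (X 0 1).imK + (X 0 0).imK) / 3)
      obtain ⟨q₂, r0, r1, r2, r3⟩ := hq (((X 0 1).imI - (X 0 0).imI) / 3)
        (((X 0 1).imJ - (X 0 0).imJ) / 3) (((X 0 1).imK - (X 0 0).imK) / 3)
      refine ⟨q₁, q₂, (X 0 1).re, p0, r0, ?_⟩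
      ext i j <;> fin_cases i <;> fin_cases j <;>
        simp [t0, t1, t2, t3, e0, e1, e2, e3, a0, p0, r0, k01, k02, k03, k11, k12, k13] <;>
        linarith
    · rintro ⟨q₁, q₂, t, h₁, h₂, rfl⟩
      constructor
      · ext i j <;> fin_cases i <;> fin_cases j <;>
          simp [h₁, h₂, t0, t1, t2, t3, e0, e1, e2, e3] <;> ring
      · apply Matrix.ext
        intro i j
        fin_cases i <;> fin_cases j <;>
          simp [Matrix.mul_apply, Fin.sum_univ_three]
  · intro q₁ q₂ h₁ h₂
    refine ⟨?_, ?_, ?_⟩ <;> apply Matrix.ext <;> intro i j <;> fin_cases i <;> fin_cases j <;>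
      simp [Matrix.mul_apply, Fin.sum_univ_three] <;> noncomm_ring
end
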